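/- Suppose the third-order ODE u‴ = f(x,u,u′,u″), with f smooth and I₃ ≠ 0, is equivalent to ū‴ = s·ū′ + ū (s a constant) under a contact transformation (x̄,ū,p̄) = (φ(x,u,p), ψ(x,u,p), χ(x,u,p)) with contact multiplier λ. Then, setting a₁ := λ, η := D̂ₓχ/D̂ₓφ and f̄ := s·χ + ψ, the following first-order PDE systems hold: (i) D̂ₓa₁ = J₃I₅a₁, (a₁)_u = −Q·a₁, (a₁)_p = (I₄I₅ − I₇/J₃)a₁, (a₁)_q = 0; (ii) D̂ₓφ = −J₃, φ_u = −I₇, φ_p = −I₄; (iii) D̂ₓη = −J₃f̄, η_u = ((s+I₅²)/2 + I₂/(2J₃²))a₁ − I₇f̄, η_p = (I₅/J₃ + I₁/(3J₃²))a₁ − I₄f̄, η_q = a₁/J₃²; D̂ₓχ = −J₃η, χ_u = −I₅a₁ − I₇η, χ_p = −a₁/J₃ − I₄η; I₇D̂ₓψ = J₃(ψ_u − a₁), ψ_x = χφ_x − p·a₁, ψ_p = −I₄χ; moreover χ = D̂ₓψ/D̂ₓφ. -/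

import Mathlib

/-!
Invariants of the third-order ODE `u''' = f(x, u, u', u'')` under contact
transformations, following Cartan's equivalence method.
We write `p = u'`, `q = u''`.
-/

noncomputable section

/-- The real cube root of a real number. -/
def cbrt (y : ℝ) : ℝ := if 0 ≤ y then y ^ ((1 : ℝ)/3) else -((-y) ^ ((1 : ℝ)/3))

/-- Functions of `(x, u, p, q)`. -/
abbrev Fn : Type := ℝ → ℝ → ℝ → ℝ → ℝ

/-- Functions of `(x, u, p)`. -/
abbrev Fn3 : Type := ℝ → ℝ → ℝ → ℝ

/-- Partial derivative in `x` of a function of `(x,u,p,q)`. -/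
def pdx (g : Fn) : Fn := fun x u p q => deriv (fun t => g t u p q) x
/-- Partial derivative in `u` of a function of `(x,u,p,q)`. -/
def pdu (g : Fn) : Fn := fun x u p q => deriv (fun t => g x t p q) u
/-- Partial derivative in `p` of a function of `(x,u,p,q)`. -/
def pdp (g : Fn) : Fn := fun x u p q => deriv (fun t => g x u t q) p
/-- Partial derivative in `q` of a function of `(x,u,p,q)`. -/
def pdq (g : Fn) : Fn := fun x u p q => deriv (fun t => g x u p t) q

/-- Partial derivative in `x` of a function of `(x,u,p)`. -/
def pdx3 (g : Fn3) : Fn3 := fun x u p => deriv (fun t => g t u p) x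
/-- Partial derivative in `u` of a function of `(x,u,p)`. -/
def pdu3 (g : Fn3) : Fn3 := fun x u p => deriv (fun t => g x t p) u
/-- Partial derivative in `p` of a function of `(x,u,p)`. -/
def pdp3 (g : Fn3) : Fn3 := fun x u p => deriv (fun t => g x u t) p

/-- Lift of a function of `(x,u,p)` to a function of `(x,u,p,q)`, constant in `q`. -/
def lift (g : Fn3) : Fn := fun x u p _ => g x u p

/-- The total derivative operator `D̂ₓ = ∂ₓ + p ∂ᵤ + q ∂ₚ + f ∂_q` of the ODE `u''' = f`. -/
def Dhat (f g : Fn) : Fn := fun x u p q =>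
  pdx g x u p q + p * pdu g x u p q + q * pdp g x u p q + f x u p q * pdq g x u p q

/-- `I₁ = −f_q`. -/
def I1 (f : Fn) : Fn := fun x u p q => -(pdq f x u p q)

/-- `I₂ = −(2/9)I₁² − f_p − (1/3)D̂ₓI₁`. -/
def I2 (f : Fn) : Fn := fun x u p q =>
  -(2/9) * (I1 f x u p q)^2 - pdp f x u p q - (1/3) * Dhat f (I1 f) x u p q

/-- `I₃ = −(1/3)I₁I₂ − f_u − (1/2)D̂ₓI₂`. -/
def I3 (f : Fn) : Fn := fun x u p q =>
  -(1/3) * I1 f x u p q * I2 f x u p q - pdu f x u p q - (1/2) * Dhat f (I2 f) x u p q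

/-- `J₃`, the real cube root of `I₃`. -/
def J3 (f : Fn) : Fn := fun x u p q => cbrt (I3 f x u p q)

/-- `I₄ = (J₃)_q`. -/
def I4 (f : Fn) : Fn := pdq (J3 f)

/-- `I₅ = (1/(3J₃²))(I₁J₃ + 3D̂ₓJ₃)`. -/
def I5 (f : Fn) : Fn := fun x u p q =>
  (1 / (3 * (J3 f x u p q)^2)) * (I1 f x u p q * J3 f x u p q + 3 * Dhat f (J3 f) x u p q)

/-- `I₇ = −(I₅)_q J₃²`. -/
def I7 (f : Fn) : Fn := fun x u p q => -(pdq (I5 f) x u p q) * (J3 f x u p q)^2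

/-- `I₉ = 2J₃D̂ₓI₅ − I₂ + J₃²I₅²`. -/
def I9 (f : Fn) : Fn := fun x u p q =>
  2 * J3 f x u p q * Dhat f (I5 f) x u p q - I2 f x u p q
    + (J3 f x u p q)^2 * (I5 f x u p q)^2

/-- `K = I₉/J₃²`. -/
def Kinv (f : Fn) : Fn := fun x u p q => I9 f x u p q / (J3 f x u p q)^2

/-- `Q = −(I₁I₇ + 3J₃²(I₅)_p + 3(J₃)_u − 3J₃I₄D̂ₓI₅)/(3J₃)`. -/
def Qinv (f : Fn) : Fn := fun x u p q =>
  -(I1 f x u p q * I7 f x u p q + 3 * (J3 f x u p q)^2 * pdp (I5 f) x u p q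
      + 3 * pdu (J3 f) x u p q
      - 3 * J3 f x u p q * I4 f x u p q * Dhat f (I5 f) x u p q)
    / (3 * J3 f x u p q)

/-- `I₆ = (2/3)(J₃)_q I₁ − (1/3)(I₁)_q J₃ − 2(J₃)_p + 2J₃I₄I₅`. -/
def I6 (f : Fn) : Fn := fun x u p q =>
  (2/3) * pdq (J3 f) x u p q * I1 f x u p q - (1/3) * pdq (I1 f) x u p q * J3 f x u p q
    - 2 * pdp (J3 f) x u p q + 2 * J3 f x u p q * I4 f x u p q * I5 f x u p q

/-- `I₈ = (I₄)_q`. -/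
def I8 (f : Fn) : Fn := pdq (I4 f)

/-- `I₁₀ = I₄D̂ₓI₇ − J₃(I₇)_p + J₃²(I₄/J₃)_u`. -/
def I10 (f : Fn) : Fn := fun x u p q =>
  I4 f x u p q * Dhat f (I7 f) x u p q - J3 f x u p q * pdp (I7 f) x u p q
    + (J3 f x u p q)^2 *
      pdu (fun x' u' p' q' => I4 f x' u' p' q' / J3 f x' u' p' q') x u p q

/-- `I₁₁ = (J₃)_u − D̂ₓI₇`. -/
def I11 (f : Fn) : Fn := fun x u p q =>
  pdu (J3 f) x u p q - Dhat f (I7 f) x u p q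

/-- `I₁₂`. -/
def I12 (f : Fn) : Fn := fun x u p q =>
  6 * I1 f x u p q * J3 f x u p q *
      (I5 f x u p q * I7 f x u p q - I4 f x u p q * Dhat f (I5 f) x u p q)
    - 18 * (J3 f x u p q)^3 * I4 f x u p q
    + 6 * pdp (I5 f) x u p q * I1 f x u p q * (J3 f x u p q)^2
    - 18 * I2 f x u p q * J3 f x u p q * I4 f x u p q * I5 f x u p q
    - 18 * J3 f x u p q * I7 f x u p q * Dhat f (I5 f) x u p q
    + 18 * (J3 f x u p q)^2 * pdu (I5 f) x u p q
    + 18 * I2 f x u p q * Dhat f (I4 f) x u p q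
    + 2 * (I1 f x u p q)^2 * I7 f x u p q
    - 9 * pdp (I2 f) x u p q * J3 f x u p q
    + 6 * (J3 f x u p q)^2 *
        pdu (fun x' u' p' q' => I1 f x' u' p' q' / J3 f x' u' p' q') x u p q
    + 36 * I2 f x u p q * I7 f x u p q

/-- `I₁₃ = (J₃I₄I₅ − I₇)D̂ₓK + J₃K_u − J₃²I₅K_p`. -/
def I13 (f : Fn) : Fn := fun x u p q =>
  (J3 f x u p q * I4 f x u p q * I5 f x u p q - I7 f x u p q) * Dhat f (Kinv f) x u p q
    + J3 f x u p q * pdu (Kinv f) x u p q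
    - (J3 f x u p q)^2 * I5 f x u p q * pdp (Kinv f) x u p q

/-- `I₁₄ = K_q`. -/
def I14 (f : Fn) : Fn := pdq (Kinv f)

/-- `I₁₅ = I₄D̂ₓK − J₃K_p`. -/
def I15 (f : Fn) : Fn := fun x u p q =>
  I4 f x u p q * Dhat f (Kinv f) x u p q - J3 f x u p q * pdp (Kinv f) x u p q

/-- The Jacobian determinant of the map `(x,u,p) ↦ (φ, ψ, χ)`. -/
def jac3 (φ ψ χ : Fn3) : Fn3 := fun x u p =>
  Matrix.det !![pdx3 φ x u p, pdu3 φ x u p, pdp3 φ x u p;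
                pdx3 ψ x u p, pdu3 ψ x u p, pdp3 ψ x u p;
                pdx3 χ x u p, pdu3 χ x u p, pdp3 χ x u p]

/-- A contact transformation `(x̄,ū,p̄) = (φ(x,u,p), ψ(x,u,p), χ(x,u,p))` on an open set
`U ⊆ ℝ³`: a smooth map with nowhere-vanishing Jacobian determinant, together with a
nowhere-vanishing contact multiplier `lam` such that `dψ − χ dφ = lam (du − p dx)`. -/
structure IsContactTransformOn (U : Set (ℝ × ℝ × ℝ)) (φ ψ χ lam : Fn3) : Prop where
  isOpen : IsOpen U
  smooth : ContDiffOn ℝ (⊤ : ℕ∞) (fun v : ℝ × ℝ × ℝ =>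
      (φ v.1 v.2.1 v.2.2, ψ v.1 v.2.1 v.2.2, χ v.1 v.2.1 v.2.2)) U
  jac_ne : ∀ x u p, (x, u, p) ∈ U → jac3 φ ψ χ x u p ≠ 0
  lam_ne : ∀ x u p, (x, u, p) ∈ U → lam x u p ≠ 0
  contact_p : ∀ x u p, (x, u, p) ∈ U → pdp3 ψ x u p - χ x u p * pdp3 φ x u p = 0
  contact_u : ∀ x u p, (x, u, p) ∈ U → pdu3 ψ x u p - χ x u p * pdu3 φ x u p = lam x u p
  contact_x : ∀ x u p, (x, u, p) ∈ U → pdx3 ψ x u p - χ x u p * pdx3 φ x u p = -p * lam x u p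

/-- `u` is a smooth solution of the third-order ODE `u''' = f(x,u,u',u'')` on `I`. -/
def SolvesODE3 (f : Fn) (I : Set ℝ) (u : ℝ → ℝ) : Prop :=
  ContDiffOn ℝ (⊤ : ℕ∞) u I ∧
  ∀ x ∈ I, deriv (deriv (deriv u)) x = f x (u x) (deriv u x) (deriv (deriv u) x)

/-- The ODE `u''' = f(x,u,u',u'')` is equivalent to `ū''' = f̄(x̄,ū,ū',ū'')` under the
contact transformation `(φ, ψ, χ)` on `U`: for every smooth solution `u` of the first
equation, defined on an open interval, whose prolonged graph `(x, u(x), u'(x))` lies in `U`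
and for which `x̄(x) := φ(x,u(x),u'(x))` has nonvanishing derivative, the function `v` of
`x̄` defined by `v(x̄(x)) = ψ(x,u(x),u'(x))` is a smooth solution of the second equation
and satisfies `dv/dx̄ = χ(x,u(x),u'(x))`. -/
def ContactEquivOn (f fbar : Fn) (U : Set (ℝ × ℝ × ℝ)) (φ ψ χ : Fn3) : Prop :=
  ∀ (I : Set ℝ) (u : ℝ → ℝ), IsOpen I → I.OrdConnected →
    SolvesODE3 f I u →
    (∀ x ∈ I, (x, u x, deriv u x) ∈ U) →
    (∀ x ∈ I, deriv (fun t => φ t (u t) (deriv u t)) x ≠ 0) →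
    ∃ v : ℝ → ℝ,
      ContDiffOn ℝ (⊤ : ℕ∞) v ((fun t => φ t (u t) (deriv u t)) '' I) ∧
      (∀ x ∈ I, v (φ x (u x) (deriv u x)) = ψ x (u x) (deriv u x)) ∧
      (∀ x ∈ I, deriv v (φ x (u x) (deriv u x)) = χ x (u x) (deriv u x)) ∧
      (∀ y ∈ (fun t => φ t (u t) (deriv u t)) '' I,
        deriv (deriv (deriv v)) y = fbar y (v y) (deriv v y) (deriv (deriv v) y))

section SmoothFunctions

open TopologicalSpace Topology
open scoped ContDiff

variable {E : Type*} [NormedAddCommGroup E] {Ω : Opens E}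

/-- Extension by zero of a function on an open set. -/
def extZero (g : Ω → ℝ) : E → ℝ := Function.extend Subtype.val g 0

lemma extZero_apply (g : Ω → ℝ) (z : Ω) : extZero g z = g z :=
  Subtype.val_injective.extend_apply g 0 z

lemma extZero_eqOn {g : Ω → ℝ} {G : E → ℝ} (h : ∀ z : Ω, G z = g z) :
    Set.EqOn (extZero g) G Ω := fun z hz => by
  rw [extZero_apply g ⟨z, hz⟩, ← h]

lemma extZero_eventuallyEq {g : Ω → ℝ} {G : E → ℝ} (h : ∀ z : Ω, G z = g z) (z : Ω) :
    G =ᶠ[𝓝 (z : E)] extZero g :=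
  ((extZero_eqOn h).eventuallyEq_of_mem (Ω.isOpen.mem_nhds z.2)).symm

lemma two_le_infty : (2 : WithTop ℕ∞) ≤ ∞ :=
  WithTop.coe_le_coe.2 (le_top : (2 : ℕ∞) ≤ ⊤)

variable [NormedSpace ℝ E]

/-- The algebra of smooth real functions on an open set. -/
def smoothFunctions (Ω : Opens E) : Subalgebra ℝ (Ω → ℝ) where
  carrier := {g | ContDiffOn ℝ ∞ (extZero g) Ω}
  mul_mem' {a b} ha hb := (ContDiffOn.mul ha hb).congr
    (extZero_eqOn fun z => by simp [extZero_apply])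
  add_mem' {a b} ha hb := (ContDiffOn.add ha hb).congr
    (extZero_eqOn fun z => by simp [extZero_apply])
  algebraMap_mem' r := (contDiffOn_const (c := r)).congr (extZero_eqOn fun z => by simp)

/-- The restriction to `Ω` of a function which is smooth there. -/
def restrictSmooth (G : E → ℝ) (hG : ContDiffOn ℝ ∞ G Ω) : smoothFunctions Ω :=
  ⟨fun z => G z, hG.congr (extZero_eqOn fun _ => rfl)⟩

lemma differentiableAt_extZero (g : smoothFunctions Ω) (z : Ω) :
    DifferentiableAt ℝ (extZero g.1) z :=
  (g.2.contDiffAt (Ω.isOpen.mem_nhds z.2)).differentiableAt (by simp)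

/-- Differentiation of smooth functions along a fixed vector. -/
def dirDeriv (v : E) : Derivation ℝ (smoothFunctions Ω) (smoothFunctions Ω) :=
  Derivation.mk'
    { toFun := fun g => restrictSmooth (fun z => fderiv ℝ (extZero g.1) z v)
        ((g.2.fderiv_of_isOpen Ω.isOpen (by simp)).clm_apply contDiffOn_const)
      map_add' := fun g h => by
        ext z
        have : fderiv ℝ (extZero (g.1 + h.1)) z = fderiv ℝ (extZero g.1 + extZero h.1) z :=
          (extZero_eventuallyEq (fun z => by simp [extZero_apply]) z).symm.fderiv_eq
        simp [restrictSmooth, this,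
          fderiv_add (differentiableAt_extZero g z) (differentiableAt_extZero h z)]
      map_smul' := fun c g => by
        ext z
        have : fderiv ℝ (extZero (c • g.1)) z = fderiv ℝ (c • extZero g.1) z :=
          (extZero_eventuallyEq (fun z => by simp [extZero_apply]) z).symm.fderiv_eq
        simp [restrictSmooth, this, fderiv_const_smul (differentiableAt_extZero g z)] }
    fun g h => by
      ext z
      have : fderiv ℝ (extZero (g.1 * h.1)) z = fderiv ℝ (extZero g.1 * extZero h.1) z :=
        (extZero_eventuallyEq (fun z => by simp [extZero_apply]) z).symm.fderiv_eq
      simp [restrictSmooth, this, extZero_apply,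
        fderiv_mul (differentiableAt_extZero g z) (differentiableAt_extZero h z)]

lemma fderiv_eq_dirDeriv {g : smoothFunctions Ω} {G : E → ℝ} (h : ∀ z : Ω, G z = g.1 z)
    (z : Ω) (v : E) : fderiv ℝ G z v = (dirDeriv v g).1 z := by
  rw [(extZero_eventuallyEq h z).fderiv_eq]; rfl

lemma dirDeriv_comm (v w : E) (g : smoothFunctions Ω) :
    dirDeriv v (dirDeriv w g) = dirDeriv w (dirDeriv v g) := by
  ext z
  have hg : ContDiffAt ℝ ∞ (extZero g.1) z := g.2.contDiffAt (Ω.isOpen.mem_nhds z.2)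
  have key : ∀ a b : E, (dirDeriv a (dirDeriv b g)).1 z
      = fderiv ℝ (fderiv ℝ (extZero g.1)) z a b := fun a b => by
    have hd : DifferentiableAt ℝ (fderiv ℝ (extZero g.1)) z :=
      (hg.fderiv_right (m := 1) (one_add_one_eq_two (R := WithTop ℕ∞) ▸ two_le_infty)).differentiableAt (by simp)
    rw [← fderiv_eq_dirDeriv (G := fun z => fderiv ℝ (extZero g.1) z b) (fun _ => rfl),
      fderiv_clm_apply hd (differentiableAt_const b)]
    simp
  rw [key, key]
  exact (hg.isSymmSndFDerivAt (by simpa using two_le_infty)) v w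

end SmoothFunctions

section Curves

open Set Topology
open scoped ContDiff

/-- A smooth vector field on an open set has a smooth integral curve through every point. -/
lemma exists_smooth_integral_curve {E : Type*} [NormedAddCommGroup E] [NormedSpace ℝ E]
    [CompleteSpace E] {W : Set E} (hW : IsOpen W) {V : E → E} (hV : ContDiffOn ℝ ∞ V W)
    {z₀ : E} (hz₀ : z₀ ∈ W) (t₀ : ℝ) :
    ∃ δ > (0 : ℝ), ∃ z : ℝ → E, z t₀ = z₀ ∧
      (∀ t ∈ Ioo (t₀ - δ) (t₀ + δ), z t ∈ W ∧ HasDerivAt z (V (z t)) t) ∧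
      ContDiffOn ℝ ∞ z (Ioo (t₀ - δ) (t₀ + δ)) := by
  have hV₀ : ContDiffAt ℝ 1 V z₀ :=
    (hV.contDiffAt (hW.mem_nhds hz₀)).of_le (by simp)
  obtain ⟨z, hz, ε, hε, hd⟩ :=
    hV₀.exists_forall_mem_closedBall_exists_eq_forall_mem_Ioo_hasDerivAt₀ t₀
  have hc : ContinuousAt z t₀ := (hd t₀ ⟨by linarith, by linarith⟩).continuousAt
  have hnhds : z ⁻¹' W ∈ 𝓝 t₀ := hc.preimage_mem_nhds (hW.mem_nhds (hz ▸ hz₀))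
  obtain ⟨δ, hδ, hball⟩ := Metric.mem_nhds_iff.1 hnhds
  set ρ := min δ ε / 2 with hρ
  have hmin : 0 < min δ ε := lt_min hδ hε
  have hsub : ∀ t ∈ Icc (t₀ - ρ) (t₀ + ρ), z t ∈ W ∧ HasDerivAt z (V (z t)) t := by
    rintro t ⟨h1, h2⟩
    have hδ' := min_le_left δ ε
    have hε' := min_le_right δ ε
    refine ⟨hball ?_, hd t ⟨by linarith, by linarith⟩⟩
    rw [Metric.mem_ball, Real.dist_eq, abs_lt]
    exact ⟨by linarith, by linarith⟩
  refine ⟨ρ, by positivity, z, hz, fun t ht => hsub t (Ioo_subset_Icc_self ht), ?_⟩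
  refine ContDiffOn.mono ?_ Ioo_subset_Icc_self
  refine ODE.contDiffOn_enat_Icc_of_hasDerivWithinAt (f := fun _ => V) (u := W) (n := ⊤) ?_
    (fun t ht => (hsub t ht).2.hasDerivWithinAt) (fun t ht => (hsub t ht).1)
  exact hV.comp contDiffOn_snd (fun w hw => hw.2)

/-- The chain rule, read off from an identity `w ∘ g = F` on an open set. -/
lemma deriv_mul_eq_of_comp_eq {I : Set ℝ} (hI : IsOpen I) {w g F : ℝ → ℝ} {g' F' t : ℝ}
    (ht : t ∈ I) (hw : DifferentiableAt ℝ w (g t)) (hg : HasDerivAt g g' t)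
    (hF : HasDerivAt F F' t) (h : ∀ a ∈ I, w (g a) = F a) : deriv w (g t) * g' = F' :=
  (((hw.hasDerivAt.comp t hg).congr_of_eventuallyEq
    (Filter.eventuallyEq_of_mem (hI.mem_nhds ht) fun a ha => (h a ha).symm))).unique hF

end Curves

section Representation

open TopologicalSpace Topology Set
open scoped ContDiff

/-- The space of the variables `(x, u, p, q)`. -/
abbrev Jet : Type := ℝ × ℝ × ℝ × ℝ

/-- A function of `(x,u,p,q)` as a function on `Jet`. -/
def unc (g : Fn) : Jet → ℝ := fun z => g z.1 z.2.1 z.2.2.1 z.2.2.2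

variable {Ω : Opens Jet}

/-- Evaluation of smooth functions at a point. -/
def evalAt (z : Ω) : smoothFunctions Ω →ₐ[ℝ] ℝ :=
  (Pi.evalAlgHom ℝ (fun _ : Ω => ℝ) z).comp (smoothFunctions Ω).val

lemma smooth_ext {a b : smoothFunctions Ω} (h : ∀ z, evalAt z a = evalAt z b) : a = b :=
  Subtype.ext (funext h)

/-- The function `g` coincides on `Ω` with the smooth function `r`. -/
def IsRep (g : Fn) (r : smoothFunctions Ω) : Prop := ∀ z : Ω, unc g z = evalAt z r

lemma IsRep.unique {g : Fn} {r r' : smoothFunctions Ω} (h : IsRep g r) (h' : IsRep g r') : r = r' :=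
  smooth_ext fun z => (h z).symm.trans (h' z)

lemma isRep_restrictSmooth {g : Fn} (hg : ContDiffOn ℝ ∞ (unc g) Ω) :
    IsRep g (restrictSmooth (unc g) hg) := fun _ => rfl

lemma IsRep.contDiffOn {g : Fn} {r : smoothFunctions Ω} (h : IsRep g r) :
    ContDiffOn ℝ ∞ (unc g) Ω :=
  r.2.congr fun _ hz => (extZero_eqOn h hz).symm

lemma IsRep.hasFDerivAt {g : Fn} {r : smoothFunctions Ω} (h : IsRep g r) (z : Ω) :
    HasFDerivAt (unc g) (fderiv ℝ (unc g) z) z :=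
  ((h.contDiffOn.contDiffAt (Ω.isOpen.mem_nhds z.2)).differentiableAt (by simp)).hasFDerivAt

lemma IsRep.fderiv_apply {g : Fn} {r : smoothFunctions Ω} (h : IsRep g r) (z : Ω) (v : Jet) :
    fderiv ℝ (unc g) z v = evalAt z (dirDeriv v r) :=
  fderiv_eq_dirDeriv h z v

/-- `∂ₓ` on smooth functions. -/
def dx : Derivation ℝ (smoothFunctions Ω) (smoothFunctions Ω) := dirDeriv (1, 0, 0, 0)
/-- `∂ᵤ` on smooth functions. -/
def du : Derivation ℝ (smoothFunctions Ω) (smoothFunctions Ω) := dirDeriv (0, 1, 0, 0)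
/-- `∂ₚ` on smooth functions. -/
def dp : Derivation ℝ (smoothFunctions Ω) (smoothFunctions Ω) := dirDeriv (0, 0, 1, 0)
/-- `∂_q` on smooth functions. -/
def dq : Derivation ℝ (smoothFunctions Ω) (smoothFunctions Ω) := dirDeriv (0, 0, 0, 1)

lemma IsRep.pdx {g : Fn} {r : smoothFunctions Ω} (h : IsRep g r) : IsRep (pdx g) (dx r) := fun z => by
  rw [dx, ← h.fderiv_apply]
  exact (HasFDerivAt.comp_hasDerivAt (f := fun t : ℝ => ((t, z.1.2) : Jet)) z.1.1 (h.hasFDerivAt z)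
    ((hasDerivAt_id _).prodMk (hasDerivAt_const _ _))).deriv

lemma IsRep.pdu {g : Fn} {r : smoothFunctions Ω} (h : IsRep g r) : IsRep (pdu g) (du r) := fun z => by
  rw [du, ← h.fderiv_apply]
  exact (HasFDerivAt.comp_hasDerivAt (f := fun t : ℝ => ((z.1.1, t, z.1.2.2) : Jet)) z.1.2.1
    (h.hasFDerivAt z) ((hasDerivAt_const _ _).prodMk
      ((hasDerivAt_id _).prodMk (hasDerivAt_const _ _)))).deriv

lemma IsRep.pdp {g : Fn} {r : smoothFunctions Ω} (h : IsRep g r) : IsRep (pdp g) (dp r) := fun z => by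
  rw [dp, ← h.fderiv_apply]
  exact (HasFDerivAt.comp_hasDerivAt (f := fun t : ℝ => ((z.1.1, z.1.2.1, t, z.1.2.2.2) : Jet))
    z.1.2.2.1 (h.hasFDerivAt z) ((hasDerivAt_const _ _).prodMk ((hasDerivAt_const _ _).prodMk
      ((hasDerivAt_id _).prodMk (hasDerivAt_const _ _))))).deriv

lemma IsRep.pdq {g : Fn} {r : smoothFunctions Ω} (h : IsRep g r) : IsRep (pdq g) (dq r) := fun z => by
  rw [dq, ← h.fderiv_apply]
  exact (HasFDerivAt.comp_hasDerivAt (f := fun t : ℝ => ((z.1.1, z.1.2.1, z.1.2.2.1, t) : Jet))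
    z.1.2.2.2 (h.hasFDerivAt z) ((hasDerivAt_const _ _).prodMk ((hasDerivAt_const _ _).prodMk
      ((hasDerivAt_const _ _).prodMk (hasDerivAt_id _))))).deriv

/-- The coordinate function `p`. -/
def coordP : smoothFunctions Ω := restrictSmooth (fun z => z.2.2.1) (by fun_prop)

/-- The coordinate function `q`. -/
def coordQ : smoothFunctions Ω := restrictSmooth (fun z => z.2.2.2) (by fun_prop)

/-- The total derivative on smooth functions. -/
def Dtot (f : smoothFunctions Ω) : Derivation ℝ (smoothFunctions Ω) (smoothFunctions Ω) :=
  dx + (coordP : smoothFunctions Ω) • (du (Ω := Ω)) + (coordQ : smoothFunctions Ω) • (dp (Ω := Ω))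
    + f • (dq (Ω := Ω))

lemma Dtot_apply (f g : smoothFunctions Ω) :
    Dtot f g = dx g + coordP * du g + coordQ * dp g + f * dq g := by
  simp [Dtot]

lemma evalAt_coordP (z : Ω) : evalAt z coordP = z.1.2.2.1 := rfl
lemma evalAt_coordQ (z : Ω) : evalAt z coordQ = z.1.2.2.2 := rfl

lemma dirDeriv_coordP (v : Jet) :
    dirDeriv v (coordP : smoothFunctions Ω) = algebraMap ℝ _ v.2.2.1 := by
  ext z
  rw [← fderiv_eq_dirDeriv (G := fun z : Jet => z.2.2.1) (fun _ => rfl)]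
  rw [show (fun z : Jet => z.2.2.1) = (ContinuousLinearMap.fst ℝ ℝ ℝ ∘L
    ContinuousLinearMap.snd ℝ ℝ (ℝ × ℝ) ∘L ContinuousLinearMap.snd ℝ ℝ (ℝ × ℝ × ℝ) : Jet →L[ℝ] ℝ)
    from rfl, ContinuousLinearMap.fderiv]
  rfl

lemma dirDeriv_coordQ (v : Jet) :
    dirDeriv v (coordQ : smoothFunctions Ω) = algebraMap ℝ _ v.2.2.2 := by
  ext z
  rw [← fderiv_eq_dirDeriv (G := fun z : Jet => z.2.2.2) (fun _ => rfl)]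
  rw [show (fun z : Jet => z.2.2.2) = (ContinuousLinearMap.snd ℝ ℝ ℝ ∘L
    ContinuousLinearMap.snd ℝ ℝ (ℝ × ℝ) ∘L ContinuousLinearMap.snd ℝ ℝ (ℝ × ℝ × ℝ) : Jet →L[ℝ] ℝ)
    from rfl, ContinuousLinearMap.fderiv]
  rfl

lemma dirDeriv_Dtot (v : Jet) (f g : smoothFunctions Ω) :
    dirDeriv v (Dtot f g) = Dtot f (dirDeriv v g) + algebraMap ℝ _ v.2.2.1 * du g
      + algebraMap ℝ _ v.2.2.2 * dp g + dirDeriv v f * dq g := by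
  simp only [Dtot_apply, map_add, Derivation.leibniz, smul_eq_mul, dirDeriv_coordP,
    dirDeriv_coordQ, dx, du, dp, dq, dirDeriv_comm v]
  ring

lemma dq_Dtot (f g : smoothFunctions Ω) :
    dq (Dtot f g) = Dtot f (dq g) + dp g + dq f * dq g :=
  (dirDeriv_Dtot (0, 0, 0, 1) f g).trans (by simp [dq])

lemma dp_Dtot (f g : smoothFunctions Ω) :
    dp (Dtot f g) = Dtot f (dp g) + du g + dp f * dq g :=
  (dirDeriv_Dtot (0, 0, 1, 0) f g).trans (by simp [dp])

lemma du_Dtot (f g : smoothFunctions Ω) :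
    du (Dtot f g) = Dtot f (du g) + du f * dq g :=
  (dirDeriv_Dtot (0, 1, 0, 0) f g).trans (by simp [du])

lemma IsRep.Dhat {f g : Fn} {fr gr : smoothFunctions Ω} (hf : IsRep f fr) (hg : IsRep g gr) :
    IsRep (Dhat f g) (Dtot fr gr) := fun z => by
  simp only [Dtot_apply, map_add, map_mul, evalAt_coordP, evalAt_coordQ, ← hf z, ← hg.pdx z,
    ← hg.pdu z, ← hg.pdp z, ← hg.pdq z]
  rfl

lemma dq_eq_zero_of_lift (g : Fn3) {r : smoothFunctions Ω} (h : IsRep (lift g) r) : dq r = 0 :=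
  smooth_ext fun z => by
    rw [← h.pdq z, map_zero]
    exact deriv_const _ _

lemma IsRep.hasDerivAt_comp {f g : Fn} {fr gr : smoothFunctions Ω} (hf : IsRep f fr) (hg : IsRep g gr)
    {c : ℝ → Jet} {t : ℝ} (ht : c t ∈ Ω)
    (hc : HasDerivAt c (1, (c t).2.2.1, (c t).2.2.2, unc f (c t)) t) :
    HasDerivAt (fun a => unc g (c a)) (evalAt ⟨c t, ht⟩ (Dtot fr gr)) t := by
  have h1 := HasFDerivAt.comp_hasDerivAt t (hg.hasFDerivAt ⟨c t, ht⟩) hc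
  have h2 : ((1, (c t).2.2.1, (c t).2.2.2, unc f (c t)) : Jet) = (1, 0, 0, 0)
      + (c t).2.2.1 • (0, 1, 0, 0) + (c t).2.2.2 • (0, 0, 1, 0) + unc f (c t) • (0, 0, 0, 1) := by
    simp
  refine h1.congr_deriv ?_
  rw [h2]
  rw [map_add, map_add, map_add, map_smul, map_smul, map_smul]
  simp only [map_add, hg.fderiv_apply ⟨c t, ht⟩, smul_eq_mul, Dtot_apply, map_mul,
    evalAt_coordP, evalAt_coordQ, ← hf ⟨c t, ht⟩]
  rfl

lemma exists_isRep (r : smoothFunctions Ω) : ∃ g, IsRep g r :=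
  ⟨fun x u p q => extZero r.1 (x, u, p, q), fun z => extZero_apply r.1 z⟩

lemma exists_mul_eq_one {g : smoothFunctions Ω} (hg : ∀ z, evalAt z g ≠ 0) : ∃ e, g * e = 1 := by
  refine ⟨restrictSmooth (fun z => (extZero g.1 z)⁻¹) (g.2.inv fun z hz => ?_), ?_⟩
  · rw [extZero_apply g.1 ⟨z, hz⟩]; exact hg ⟨z, hz⟩
  · refine smooth_ext fun z => ?_
    have : evalAt z (restrictSmooth (fun z => (extZero g.1 z)⁻¹) (g.2.inv fun z hz => by
      rw [extZero_apply g.1 ⟨z, hz⟩]; exact hg ⟨z, hz⟩)) = (evalAt z g)⁻¹ :=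
      congrArg _ (extZero_apply g.1 z)
    rw [map_mul, this, mul_inv_cancel₀ (hg z), map_one]

end Representation

section Solutions

open TopologicalSpace Topology Set
open scoped ContDiff

variable {Ω : Opens Jet}

lemma contDiffAt_deriv {v : ℝ → ℝ} {t : ℝ} (hv : ContDiffAt ℝ ∞ v t) :
    ContDiffAt ℝ ∞ (deriv v) t :=
  hv.derivWithin (by simp)

/-- Equivalence to `u''' = s u' + u` expresses the total derivative of the transformed second
derivative `η`. -/
lemma Dtot_eta_of_contactEquivOn {f : Fn} {φ ψ χ : Fn3} {s : ℝ} {U : Set (ℝ × ℝ × ℝ)}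
    (hU : ∀ z ∈ Ω, (z.1, z.2.1, z.2.2.1) ∈ U) {fr φr ψr χr ηr : smoothFunctions Ω}
    (hf : IsRep f fr) (hφ : IsRep (lift φ) φr) (hψ : IsRep (lift ψ) ψr) (hχ : IsRep (lift χ) χr)
    (hE : ∀ z, evalAt z (Dtot fr φr) ≠ 0) (hη : Dtot fr χr = ηr * Dtot fr φr)
    (heqv : ContactEquivOn f (fun _ ub pb _ => s * pb + ub) U φ ψ χ) :
    Dtot fr ηr = Dtot fr φr * (algebraMap ℝ _ s * χr + ψr) := by
  refine smooth_ext fun z₀ => ?_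
  have hV : ContDiffOn ℝ ∞ (fun z : Jet => ((1, z.2.2.1, z.2.2.2, unc f z) : Jet)) Ω := by
    have := hf.contDiffOn
    fun_prop
  obtain ⟨δ, hδ, c, hc₀, hc, hsm⟩ := exists_smooth_integral_curve Ω.isOpen hV z₀.2 z₀.1.1
  set I := Ioo (z₀.1.1 - δ) (z₀.1.1 + δ) with hI
  have hIo : IsOpen I := isOpen_Ioo
  have h₀ : z₀.1.1 ∈ I := ⟨by linarith, by linarith⟩
  have hd1 : ∀ t ∈ I, HasDerivAt (fun a => (c a).1) _ t := fun t ht =>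
    hasFDerivAt_fst.comp_hasDerivAt t (hc t ht).2
  have hd2 : ∀ t ∈ I, HasDerivAt (fun a => (c a).2) _ t := fun t ht =>
    hasFDerivAt_snd.comp_hasDerivAt t (hc t ht).2
  have hd3 : ∀ t ∈ I, HasDerivAt (fun a => (c a).2.2) _ t := fun t ht =>
    hasFDerivAt_snd.comp_hasDerivAt t (hd2 t ht)
  have hu : ∀ t ∈ I, HasDerivAt (fun a => (c a).2.1) _ t := fun t ht =>
    hasFDerivAt_fst.comp_hasDerivAt t (hd2 t ht)
  have hp : ∀ t ∈ I, HasDerivAt (fun a => (c a).2.2.1) _ t := fun t ht =>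
    hasFDerivAt_fst.comp_hasDerivAt t (hd3 t ht)
  have hq : ∀ t ∈ I, HasDerivAt (fun a => (c a).2.2.2) _ t := fun t ht =>
    hasFDerivAt_snd.comp_hasDerivAt t (hd3 t ht)
  have hx : ∀ t ∈ I, (c t).1 = t := by
    intro t ht
    have hdiff : ∀ a ∈ I, HasDerivAt (fun a => (c a).1 - a) 0 a := fun a ha =>
      ((hd1 a ha).sub (hasDerivAt_id a)).congr_deriv (sub_self 1)
    have := hIo.is_const_of_deriv_eq_zero isPreconnected_Ioo
      (fun a ha => (hdiff a ha).differentiableAt.differentiableWithinAt)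
      (fun a ha => (hdiff a ha).deriv) ht h₀
    simp only [hc₀, sub_self] at this
    linarith
  set u : ℝ → ℝ := fun a => (c a).2.1 with hu_def
  have hu1 : ∀ t ∈ I, deriv u t = (c t).2.2.1 := fun t ht => (hu t ht).deriv
  have hu2 : ∀ t ∈ I, deriv (deriv u) t = (c t).2.2.2 := fun t ht =>
    ((Filter.eventuallyEq_of_mem (hIo.mem_nhds ht) hu1).deriv_eq).trans (hp t ht).deriv
  have hu3 : ∀ t ∈ I, deriv (deriv (deriv u)) t = unc f (c t) := fun t ht =>
    ((Filter.eventuallyEq_of_mem (hIo.mem_nhds ht) hu2).deriv_eq).trans (hq t ht).deriv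
  have hlift : ∀ g : Fn3, ∀ t ∈ I, g t (u t) (deriv u t) = unc (lift g) (c t) := fun g t ht => by
    rw [hu1 t ht]
    simp only [unc, lift, hx t ht, hu_def]
  set G : ℝ → ℝ := fun t => unc (lift φ) (c t) with hG_def
  have hcΩ : ∀ t ∈ I, c t ∈ Ω := fun t ht => (hc t ht).1
  have hG : ∀ t (ht : t ∈ I), HasDerivAt G (evalAt ⟨c t, hcΩ t ht⟩ (Dtot fr φr)) t :=
    fun t ht => hf.hasDerivAt_comp hφ (hcΩ t ht) (hc t ht).2
  have hGsm : ContDiffOn ℝ ∞ G I := hφ.contDiffOn.comp hsm hcΩ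
  have himg : (fun t => φ t (u t) (deriv u t)) '' I = G '' I := image_congr (hlift φ)
  obtain ⟨v, hv, hv0, hv1, hv3⟩ := heqv I u hIo ordConnected_Ioo
    ⟨by have : ContDiffOn ℝ ∞ (fun a => (c a).2.1) I := by fun_prop
        exact this,
      fun t ht => by rw [hu3 t ht, hu2 t ht, hu1 t ht]; simp only [unc, hx t ht, hu_def]⟩
    (fun t ht => by
      have := hU _ (hcΩ t ht)
      rwa [hx t ht, ← hu1 t ht] at this)
    (fun t ht => by
      rw [(Filter.eventuallyEq_of_mem (hIo.mem_nhds ht) (hlift φ)).deriv_eq]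
      exact (hG t ht).deriv ▸ hE _)
  rw [himg] at hv hv3
  have hvsm : ∀ t ∈ I, ContDiffAt ℝ ∞ v (G t) := fun t ht => by
    refine hv.contDiffAt ?_
    have hst : HasStrictDerivAt G (evalAt ⟨c t, hcΩ t ht⟩ (Dtot fr φr)) t :=
      (hGsm.contDiffAt (hIo.mem_nhds ht)).hasStrictDerivAt' (hG t ht) (by simp)
    rw [← hst.map_nhds_eq (hE _)]
    exact Filter.image_mem_map (hIo.mem_nhds ht)
  have hdv : ∀ t ∈ I, ContDiffAt ℝ ∞ (deriv v) (G t) := fun t ht =>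
    contDiffAt_deriv (hvsm t ht)
  have hddv : ∀ t ∈ I, ContDiffAt ℝ ∞ (deriv (deriv v)) (G t) := fun t ht =>
    contDiffAt_deriv (hdv t ht)
  obtain ⟨g, hg⟩ := exists_isRep ηr
  have hv2 : ∀ t ∈ I, deriv (deriv v) (G t) = unc g (c t) := fun t ht => by
    have h1 := deriv_mul_eq_of_comp_eq hIo ht ((hdv t ht).differentiableAt (by simp)) (hG t ht)
      (hf.hasDerivAt_comp hχ (hcΩ t ht) (hc t ht).2)
      (fun a ha => by rw [← hlift χ a ha, ← hv1 a ha, hlift φ a ha])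
    rw [hη, map_mul] at h1
    rw [hg ⟨c t, hcΩ t ht⟩]
    exact mul_right_cancel₀ (hE _) h1
  have h3 := deriv_mul_eq_of_comp_eq hIo h₀ ((hddv _ h₀).differentiableAt (by simp)) (hG _ h₀)
      (hf.hasDerivAt_comp hg (hcΩ _ h₀) (hc _ h₀).2) hv2
  have e0 := hv0 _ h₀
  have e1 := hv1 _ h₀
  rw [hlift φ _ h₀, hlift ψ _ h₀] at e0
  rw [hlift φ _ h₀, hlift χ _ h₀] at e1
  rw [hv3 _ (mem_image_of_mem G h₀)] at h3
  simp only [hG_def, e0, e1] at h3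
  have hz : (⟨c z₀.1.1, hcΩ _ h₀⟩ : Ω) = z₀ := Subtype.ext hc₀
  rw [hz, hc₀, hψ z₀, hχ z₀] at h3
  simp [← h3, mul_comm]

end Solutions
/-- A ring `R` of functions of `(x, u, p, q)` with the derivations `D = D̂ₓ`, `U = ∂ᵤ`, `P = ∂ₚ`,
`Q = ∂_q` attached to the equation `u''' = f`, together with a contact transformation
`(φ, ψ, χ)` with multiplier `lam` which takes it to `u''' = s u' + u`. The element `η` is the
transformed second derivative, and `e`, `li` are the inverses of `D φ` and `lam`. -/
structure ContactJet (R : Type*) [CommRing R] [Algebra ℝ R] where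
  (D U P Q : Derivation ℝ R R)
  (f φ ψ χ lam η e li : R)
  s : ℝ
  comm_Q : ∀ g, Q (D g) = D (Q g) + P g + Q f * Q g
  comm_P : ∀ g, P (D g) = D (P g) + U g + P f * Q g
  comm_U : ∀ g, U (D g) = D (U g) + U f * Q g
  comm_PU : ∀ g, P (U g) = U (P g)
  Qφ : Q φ = 0
  Qψ : Q ψ = 0
  Qχ : Q χ = 0
  Qlam : Q lam = 0
  he : D φ * e = 1
  hli : lam * li = 1
  Uψ : U ψ = χ * U φ + lam
  Pψ : P ψ = χ * P φ
  Dψ : D ψ = χ * D φ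
  Dχ : D χ = η * D φ
  Dη : D η = D φ * (algebraMap ℝ R s * χ + ψ)

namespace ContactJet

variable {R : Type*} [CommRing R] [Algebra ℝ R] (S : ContactJet R)

/-- The total derivative of `φ`. -/
def E : R := S.D S.φ
/-- The element representing the invariant `I₅`. -/
def y : R := -(S.li * S.e * S.D S.lam)
/-- The logarithmic derivative of `E`. -/
def m : R := S.e * S.D S.E
/-- The transformed right-hand side. -/
def h : R := algebraMap ℝ R S.s * S.χ + S.ψ

lemma Ee : S.E * S.e = 1 := S.he

lemma DE : S.D S.E = S.m * S.E := by
  unfold m; linear_combination (-S.D S.E) * S.Ee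

lemma De : S.D S.e = -(S.m * S.e) := by
  have h1 := congrArg S.D S.Ee
  simp only [Derivation.leibniz, smul_eq_mul, Derivation.map_one_eq_zero, S.DE] at h1
  linear_combination S.e * h1 - (S.D S.e + S.m * S.e) * S.Ee

lemma Dlam : S.D S.lam = -(S.y * S.E * S.lam) := by
  unfold y
  linear_combination (-S.D S.lam) * S.Ee - S.D S.lam * S.E * S.e * S.hli

lemma QE : S.Q S.E = S.P S.φ := by
  simp [E, S.comm_Q, S.Qφ]

lemma PE : S.P S.E = S.D (S.P S.φ) + S.U S.φ := by
  simp [E, S.comm_P, S.Qφ]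

lemma UE : S.U S.E = S.D (S.U S.φ) := by
  simp [E, S.comm_U, S.Qφ]

lemma Dψ' : S.D S.ψ = S.χ * S.E := S.Dψ
lemma Dχ' : S.D S.χ = S.η * S.E := S.Dχ
lemma Dη' : S.D S.η = S.E * S.h := S.Dη

lemma Pχ : S.P S.χ = S.lam * S.e + S.η * S.P S.φ := by
  have h1 := congrArg S.P S.Dψ'
  simp only [Derivation.leibniz, smul_eq_mul, S.comm_P, S.Qψ, S.Pψ, S.Uψ, S.PE, S.Dχ'] at h1
  linear_combination (-S.e) * h1 + (S.η * S.P S.φ - S.P S.χ) * S.Ee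

lemma Uχ : S.U S.χ = -(S.y * S.lam) + S.η * S.U S.φ := by
  have h1 := congrArg S.U S.Dψ'
  simp only [Derivation.leibniz, smul_eq_mul, S.comm_U, S.Qψ, S.Uψ, S.UE, S.Dχ', map_add,
    S.Dlam] at h1
  linear_combination (-S.e) * h1 + (S.η * S.U S.φ - S.U S.χ - S.y * S.lam) * S.Ee

lemma Qη : S.Q S.η = S.lam * S.e ^ 2 := by
  have h1 := congrArg S.Q S.Dχ'
  simp only [Derivation.leibniz, smul_eq_mul, S.comm_Q, S.Qχ, S.Pχ, S.QE, map_zero] at h1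
  linear_combination (-S.e) * h1 - S.Q S.η * S.Ee

lemma Pη : S.P S.η = -(2 * S.y * S.lam * S.e) - S.lam * S.m * S.e ^ 2 + S.h * S.P S.φ := by
  have h1 := congrArg S.P S.Dχ'
  simp only [Derivation.leibniz, smul_eq_mul, S.comm_P, S.Qχ, S.Pχ, S.Uχ, S.PE, map_add,
    S.Dlam, S.De, S.Dη'] at h1
  linear_combination (-S.e) * h1 +
    (-S.P S.η + S.h * S.P S.φ - S.y * S.lam * S.e) * S.Ee

lemma Uη : S.U S.η = (-(S.D S.y * S.e) + S.y ^ 2) * S.lam + S.h * S.U S.φ := by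
  have h1 := congrArg S.U S.Dχ'
  simp only [Derivation.leibniz, smul_eq_mul, S.comm_U, S.Qχ, S.Uχ, S.UE, map_add, map_neg,
    S.Dlam, S.Dη'] at h1
  linear_combination (-S.e) * h1 +
    (-S.U S.η + S.h * S.U S.φ + S.y ^ 2 * S.lam) * S.Ee

lemma Dh : S.D S.h = algebraMap ℝ R S.s * (S.η * S.E) + S.χ * S.E := by
  simp [h, S.Dχ', S.Dψ']

lemma Qh : S.Q S.h = 0 := by simp [h, S.Qχ, S.Qψ]

lemma Ph : S.P S.h
    = algebraMap ℝ R S.s * (S.lam * S.e + S.η * S.P S.φ) + S.χ * S.P S.φ := by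
  simp [h, S.Pχ, S.Pψ]

lemma Uh : S.U S.h = algebraMap ℝ R S.s * (-(S.y * S.lam) + S.η * S.U S.φ)
    + (S.χ * S.U S.φ + S.lam) := by
  simp [h, S.Uχ, S.Uψ]

lemma Plam : S.P S.lam = -(S.y * S.lam * S.P S.φ) - S.lam * S.e * S.U S.φ := by
  have h1 := S.comm_PU S.ψ
  simp only [Derivation.leibniz, smul_eq_mul, S.Uψ, S.Pψ, S.Pχ, S.Uχ, map_add, S.comm_PU] at h1
  linear_combination h1

/-- A multiple of `lam * e ^ 2` vanishes only if the other factor does. -/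
lemma cancel {a : R} (ha : S.lam * S.e ^ 2 * a = 0) : a = 0 := by
  have h1 : S.li * S.E ^ 2 * (S.lam * S.e ^ 2 * a) = a := by
    linear_combination (S.E * S.e + 1) * a * S.Ee + S.E ^ 2 * S.e ^ 2 * a * S.hli
  rw [← h1, ha, mul_zero]

lemma Qf : S.Q S.f = 3 * (S.y * S.E + S.m) := by
  have h1 := congrArg S.Q S.Dη'
  simp only [Derivation.leibniz, Derivation.leibniz_pow, nsmul_eq_mul, smul_eq_mul, S.comm_Q, S.Qη,
    S.Pη, S.QE, S.Qh, S.Dlam, S.De] at h1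
  refine sub_eq_zero.1 (S.cancel ?_)
  push_cast at h1
  linear_combination h1 + (-3 * S.lam * S.y * S.e + S.lam * S.y * S.e) * S.Ee

lemma Dtwo : S.D 2 = 0 := by
  exact_mod_cast S.D.map_natCast 2

lemma Dthree : S.D 3 = 0 := by
  exact_mod_cast S.D.map_natCast 3

lemma Pf : S.P S.f = algebraMap ℝ R S.s * S.E ^ 2 + 3 * S.D S.y * S.E - 3 * S.y ^ 2 * S.E ^ 2
    - 3 * S.y * S.m * S.E + S.D S.m - 2 * S.m ^ 2 := by
  have h1 := congrArg S.P S.Dη'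
  simp only [Derivation.leibniz, Derivation.leibniz_pow, nsmul_eq_mul, smul_eq_mul, S.comm_P, S.Qη,
    S.Pη, S.Uη, S.PE, S.Ph, S.Dh, S.Dlam, S.De, map_add, map_sub, map_neg, S.Dtwo] at h1
  push_cast at h1
  have h2 := S.Ee
  refine sub_eq_zero.1 (S.cancel ?_)
  grind

lemma Uf : S.U S.f = (1 - algebraMap ℝ R S.s * S.y) * S.E ^ 3 + S.D (S.D S.y) * S.E
    - S.D S.y * S.m * S.E - 3 * S.y * S.D S.y * S.E ^ 2 + S.y ^ 3 * S.E ^ 3 := by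
  have h1 := congrArg S.U S.Dη'
  simp only [Derivation.leibniz, Derivation.leibniz_pow, nsmul_eq_mul, smul_eq_mul, S.comm_U, S.Qη,
    S.Uη, S.UE, S.Uh, S.Dh, S.Dlam, S.De, map_add, map_neg] at h1
  push_cast at h1
  have h2 := S.Ee
  refine sub_eq_zero.1 (S.cancel ?_)
  grind

/-- The element representing the invariant `I₂`. -/
def i2 : R := S.y ^ 2 * S.E ^ 2 - algebraMap ℝ R S.s * S.E ^ 2 - 2 * S.D S.y * S.E

lemma i2_eq : 9 * S.i2 = -2 * (S.Q S.f) ^ 2 - 9 * S.P S.f + 3 * S.D (S.Q S.f) := by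
  simp only [S.Qf, S.Pf, i2, Derivation.leibniz, smul_eq_mul, map_add, S.DE, S.Dthree]
  ring

lemma cube_E : -6 * S.E ^ 3 = 2 * S.Q S.f * S.i2 - 6 * S.U S.f - 3 * S.D S.i2 := by
  simp only [S.Qf, S.Uf, i2, Derivation.leibniz, Derivation.leibniz_pow, nsmul_eq_mul, smul_eq_mul,
    map_sub, S.DE, S.Dtwo, Derivation.map_algebraMap]
  push_cast
  ring

lemma Qy : S.Q S.y * S.E ^ 2 = S.U S.φ := by
  have h1 := congrArg S.Q S.Dlam
  simp only [Derivation.leibniz, smul_eq_mul, S.comm_Q, S.Qlam, S.Plam, S.QE, map_zero,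
    map_neg] at h1
  linear_combination S.li * S.E * h1 + (S.U S.φ - S.Q S.y * S.E ^ 2) * S.hli
    + S.lam * S.li * S.U S.φ * S.Ee

lemma Ulam : S.E * S.U S.lam = -((S.y * S.E + S.m) * S.U S.φ + S.E ^ 2 * S.P S.y
    - S.D (S.U S.φ) - S.E * S.P S.φ * S.D S.y) * S.lam := by
  have h1 := congrArg S.P S.Dlam
  rw [S.comm_P, S.Qlam, S.Plam] at h1
  simp only [Derivation.leibniz, smul_eq_mul, S.Plam, S.PE, map_sub, S.Dlam, S.De, map_neg] at h1
  have h2 := S.Ee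
  grind

end ContactJet

section Models

open TopologicalSpace Topology Set
open scoped ContDiff

variable {Ω : Opens Jet}

/-- A `ContactJet` on smooth functions whose data are the given functions of `(x,u,p,q)`. -/
structure Models (f : Fn) (φ ψ χ lam : Fn3) (s : ℝ) (S : ContactJet (smoothFunctions Ω)) :
    Prop where
  D_eq : S.D = Dtot S.f
  U_eq : S.U = du
  P_eq : S.P = dp
  Q_eq : S.Q = dq
  rep_f : IsRep f S.f
  rep_φ : IsRep (lift φ) S.φ
  rep_ψ : IsRep (lift ψ) S.ψ
  rep_χ : IsRep (lift χ) S.χ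
  rep_lam : IsRep (lift lam) S.lam
  rep_η : IsRep (fun x u p q => Dhat f (lift χ) x u p q / Dhat f (lift φ) x u p q) S.η
  s_eq : S.s = s

section Existence

variable {f : Fn} {φ ψ χ lam : Fn3} {s : ℝ} {U : Set (ℝ × ℝ × ℝ)}

lemma IsContactTransformOn.contDiffOn_lift (hct : IsContactTransformOn U φ ψ χ lam)
    (hU : ∀ z ∈ Ω, (z.1, z.2.1, z.2.2.1) ∈ U) :
    ContDiffOn ℝ ∞ (unc (lift φ)) Ω ∧ ContDiffOn ℝ ∞ (unc (lift ψ)) Ω ∧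
      ContDiffOn ℝ ∞ (unc (lift χ)) Ω := by
  have h := hct.smooth.comp (s := (Ω : Set Jet)) (f := fun z : Jet => (z.1, z.2.1, z.2.2.1))
    (by fun_prop) hU
  exact ⟨h.fst, h.snd.fst, h.snd.snd⟩

lemma exists_models (hct : IsContactTransformOn U φ ψ χ lam)
    (heqv : ContactEquivOn f (fun _ ub pb _ => s * pb + ub) U φ ψ χ)
    (hU : ∀ z ∈ Ω, (z.1, z.2.1, z.2.2.1) ∈ U) (hf : ContDiffOn ℝ ∞ (unc f) Ω)
    (hE : ∀ z ∈ Ω, unc (Dhat f (lift φ)) z ≠ 0) :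
    ∃ S : ContactJet (smoothFunctions Ω), Models f φ ψ χ lam s S := by
  obtain ⟨h1, h2, h3⟩ := hct.contDiffOn_lift hU
  have hfr := isRep_restrictSmooth hf
  have hφr := isRep_restrictSmooth h1
  have hψr := isRep_restrictSmooth h2
  have hχr := isRep_restrictSmooth h3
  set fr := restrictSmooth _ hf
  set φr := restrictSmooth _ h1
  set ψr := restrictSmooth _ h2
  set χr := restrictSmooth _ h3
  have hlam : IsRep (lift lam) (du ψr - χr * du φr) := fun z => by
    rw [map_sub, map_mul, ← hψr.pdu, ← hφr.pdu, ← hχr]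
    exact (hct.contact_u _ _ _ (hU _ z.2)).symm
  obtain ⟨lamr, hlamr⟩ : ∃ r, r = du ψr - χr * du φr := ⟨_, rfl⟩
  rw [← hlamr] at hlam
  have hPψ : dp ψr = χr * dp φr := smooth_ext fun z => by
    rw [map_mul, ← hψr.pdp, ← hφr.pdp, ← hχr]
    exact sub_eq_zero.1 (hct.contact_p _ _ _ (hU _ z.2))
  have hXψ : dx ψr = χr * dx φr - coordP * lamr := smooth_ext fun z => by
    rw [map_sub, map_mul, map_mul, ← hψr.pdx, ← hφr.pdx, ← hχr, ← hlam, evalAt_coordP]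
    exact sub_eq_iff_eq_add'.1 (hct.contact_x _ _ _ (hU _ z.2)) |>.trans (by
      simp only [unc, lift]; ring_nf; rfl)
  have hQφ := dq_eq_zero_of_lift φ hφr
  have hQψ := dq_eq_zero_of_lift ψ hψr
  have hE' : ∀ z, evalAt z (Dtot fr φr) ≠ 0 := fun z => by
    rw [← hfr.Dhat hφr]; exact hE _ z.2
  obtain ⟨e, he⟩ := exists_mul_eq_one hE'
  obtain ⟨li, hli⟩ := exists_mul_eq_one (g := lamr) fun z => by
    rw [← hlam]; exact hct.lam_ne _ _ _ (hU _ z.2)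
  have hDχ : Dtot fr χr = Dtot fr χr * e * Dtot fr φr := by
    rw [mul_assoc, mul_comm e, he, mul_one]
  refine ⟨{ D := Dtot fr, U := du, P := dp, Q := dq, f := fr, φ := φr, ψ := ψr, χ := χr,
            lam := lamr, η := Dtot fr χr * e, e := e, li := li, s := s,
            comm_Q := dq_Dtot fr, comm_P := dp_Dtot fr, comm_U := du_Dtot fr,
            comm_PU := dirDeriv_comm _ _, Qφ := hQφ, Qψ := hQψ,
            Qχ := dq_eq_zero_of_lift χ hχr, Qlam := dq_eq_zero_of_lift lam hlam,
            he := he, hli := hli, Uψ := by rw [hlamr]; ring, Pψ := hPψ,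
            Dψ := ?_, Dχ := hDχ,
            Dη := Dtot_eta_of_contactEquivOn hU hfr hφr hψr hχr hE' hDχ heqv },
    { D_eq := rfl, U_eq := rfl, P_eq := rfl, Q_eq := rfl, rep_f := hfr, rep_φ := hφr,
      rep_ψ := hψr, rep_χ := hχr, rep_lam := hlam, rep_η := fun z => ?_, s_eq := rfl }⟩
  · rw [Dtot_apply, Dtot_apply, hXψ, hPψ, hQφ, hQψ, hlamr]
    ring
  · refine (congrArg₂ (· / ·) (hfr.Dhat hχr z) (hfr.Dhat hφr z)).trans ?_
    simp only
    rw [div_eq_iff (hE' z), ← map_mul, ← hDχ]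

/-- The total derivative of `φ` does not vanish identically on any nonempty open set. -/
lemma exists_Dhat_ne_zero (hct : IsContactTransformOn U φ ψ χ lam)
    (hU : ∀ z ∈ Ω, (z.1, z.2.1, z.2.2.1) ∈ U) (hf : ContDiffOn ℝ ∞ (unc f) Ω)
    {z : Jet} (hz : z ∈ Ω) : ∃ w ∈ Ω, unc (Dhat f (lift φ)) w ≠ 0 := by
  by_contra! h
  have hfr := isRep_restrictSmooth hf
  have hφr := isRep_restrictSmooth (hct.contDiffOn_lift hU).1
  set fr := restrictSmooth _ hf
  set φr := restrictSmooth _ (hct.contDiffOn_lift hU).1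
  have h0 : Dtot fr φr = 0 := smooth_ext fun w => by
    rw [← hfr.Dhat hφr, h _ w.2, map_zero]
  have hq := dq_eq_zero_of_lift φ hφr
  have hp : dp φr = 0 := by
    have := dq_Dtot fr φr
    rwa [h0, hq, map_zero, map_zero, mul_zero, add_zero, zero_add, eq_comm] at this
  have hu : du φr = 0 := by
    have := dp_Dtot fr φr
    rwa [h0, hq, hp, map_zero, map_zero, mul_zero, add_zero, zero_add, eq_comm] at this
  have hx : dx φr = 0 := by
    have := Dtot_apply fr φr
    rwa [h0, hq, hp, hu, mul_zero, mul_zero, mul_zero, add_zero, add_zero, add_zero,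
      eq_comm] at this
  have h1 := hφr.pdx ⟨z, hz⟩
  have h2 := hφr.pdu ⟨z, hz⟩
  have h3 := hφr.pdp ⟨z, hz⟩
  rw [hx, map_zero] at h1
  rw [hu, map_zero] at h2
  rw [hp, map_zero] at h3
  refine hct.jac_ne _ _ _ (hU z hz) ?_
  have h1' : pdx3 φ z.1 z.2.1 z.2.2.1 = 0 := h1
  have h2' : pdu3 φ z.1 z.2.1 z.2.2.1 = 0 := h2
  have h3' : pdp3 φ z.1 z.2.1 z.2.2.1 = 0 := h3
  simp [jac3, Matrix.det_fin_three, h1', h2', h3']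

lemma contDiffOn_I3 (hf : ContDiffOn ℝ ∞ (unc f) Ω) : ContDiffOn ℝ ∞ (unc (I3 f)) Ω := by
  have hfr := isRep_restrictSmooth hf
  have h1 : ContDiffOn ℝ ∞ (unc (I1 f)) Ω := hfr.pdq.contDiffOn.neg
  have h2 : ContDiffOn ℝ ∞ (unc (I2 f)) Ω := by
    have hp := hfr.pdp.contDiffOn
    have hd := (hfr.Dhat (isRep_restrictSmooth h1)).contDiffOn
    change ContDiffOn ℝ ∞ (fun z => -(2/9) * unc (I1 f) z ^ 2 - unc (pdp f) z
      - (1/3) * unc (Dhat f (I1 f)) z) Ω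
    fun_prop
  have hu := hfr.pdu.contDiffOn
  have hd := (hfr.Dhat (isRep_restrictSmooth h2)).contDiffOn
  change ContDiffOn ℝ ∞ (fun z => -(1/3) * unc (I1 f) z * unc (I2 f) z - unc (pdu f) z
      - (1/2) * unc (Dhat f (I2 f)) z) Ω
  fun_prop

end Existence

lemma cbrt_neg_pow_three (a : ℝ) : cbrt (-a ^ 3) = -a := by
  have key : ∀ b : ℝ, 0 ≤ b → (b ^ 3) ^ ((1 : ℝ) / 3) = b := fun b hb => by
    simpa using Real.pow_rpow_inv_natCast hb (n := 3) (by norm_num)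
  unfold cbrt
  split_ifs with h
  · have ha : a ≤ 0 := by
      by_contra! ha
      have := pow_pos ha 3
      linarith
    rw [show -a ^ 3 = (-a) ^ 3 by ring, key _ (by linarith)]
  · have ha : 0 ≤ a := by
      by_contra! ha
      have := pow_pos (neg_pos.2 ha) 3
      exact h (by linarith [show (-a) ^ 3 = -a ^ 3 by ring])
    rw [neg_neg, key _ ha]

lemma ContactJet.evalAt_E_ne_zero (S : ContactJet (smoothFunctions Ω)) (z : Ω) :
    evalAt z S.E ≠ 0 := fun h => by
  simpa [h] using congrArg (evalAt z) S.Ee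

namespace Models

variable {f : Fn} {φ ψ χ lam : Fn3} {s : ℝ} {S : ContactJet (smoothFunctions Ω)} {g : Fn}
  {r : smoothFunctions Ω}

lemma rep_Dhat (M : Models f φ ψ χ lam s S) (h : IsRep g r) : IsRep (Dhat f g) (S.D r) := M.D_eq ▸ M.rep_f.Dhat h
lemma rep_pdu (M : Models f φ ψ χ lam s S) (h : IsRep g r) : IsRep (pdu g) (S.U r) := M.U_eq ▸ h.pdu
lemma rep_pdp (M : Models f φ ψ χ lam s S) (h : IsRep g r) : IsRep (pdp g) (S.P r) := M.P_eq ▸ h.pdp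
lemma rep_pdq (M : Models f φ ψ χ lam s S) (h : IsRep g r) : IsRep (pdq g) (S.Q r) := M.Q_eq ▸ h.pdq

lemma rep_I1 (M : Models f φ ψ χ lam s S) : IsRep (I1 f) (-S.Q S.f) := fun z => by
  rw [map_neg, ← M.rep_pdq M.rep_f]; rfl

lemma rep_I2 (M : Models f φ ψ χ lam s S) : IsRep (I2 f) S.i2 := fun z => by
  have h := congrArg (evalAt z) S.i2_eq
  change -(2/9) * unc (I1 f) z ^ 2 - unc (pdp f) z - (1/3) * unc (Dhat f (I1 f)) z = _
  rw [M.rep_I1, M.rep_pdp M.rep_f, M.rep_Dhat M.rep_I1]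
  simp only [map_add, map_sub, map_mul, map_neg, map_pow, map_ofNat] at h ⊢
  linear_combination (-1/9) * h

lemma rep_I3 (M : Models f φ ψ χ lam s S) : IsRep (I3 f) (-S.E ^ 3) := fun z => by
  have h := congrArg (evalAt z) S.cube_E
  change -(1/3) * unc (I1 f) z * unc (I2 f) z - unc (pdu f) z - (1/2) * unc (Dhat f (I2 f)) z = _
  rw [M.rep_I1, M.rep_I2, M.rep_pdu M.rep_f, M.rep_Dhat M.rep_I2]
  simp only [map_sub, map_mul, map_neg, map_pow, map_ofNat] at h ⊢
  linear_combination (-1/6) * h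

lemma rep_J3 (M : Models f φ ψ χ lam s S) : IsRep (J3 f) (-S.E) := fun z => by
  change cbrt (unc (I3 f) z) = _
  rw [M.rep_I3, map_neg, map_pow, map_neg, cbrt_neg_pow_three]

lemma rep_I4 (M : Models f φ ψ χ lam s S) : IsRep (I4 f) (-S.P S.φ) := fun z => by
  rw [← S.QE, ← map_neg]
  exact M.rep_pdq M.rep_J3 z

lemma rep_I5 (M : Models f φ ψ χ lam s S) : IsRep (I5 f) S.y := fun z => by
  change (1 / (3 * unc (J3 f) z ^ 2)) * (unc (I1 f) z * unc (J3 f) z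
    + 3 * unc (Dhat f (J3 f)) z) = _
  rw [M.rep_J3, M.rep_I1, M.rep_Dhat M.rep_J3, S.Qf, map_neg S.D, S.DE]
  have h := S.evalAt_E_ne_zero z
  simp only [map_add, map_mul, map_neg, map_ofNat]
  field_simp
  ring

lemma rep_I7 (M : Models f φ ψ χ lam s S) : IsRep (I7 f) (-S.U S.φ) := fun z => by
  change -unc (pdq (I5 f)) z * unc (J3 f) z ^ 2 = _
  rw [M.rep_pdq M.rep_I5, M.rep_J3, ← S.Qy]
  simp

lemma unc_Qinv_mul_lam (M : Models f φ ψ χ lam s S) (z : Ω) :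
    unc (Qinv f) z * evalAt z S.lam = -evalAt z (S.U S.lam) := by
  change -(unc (I1 f) z * unc (I7 f) z + 3 * unc (J3 f) z ^ 2 * unc (pdp (I5 f)) z
      + 3 * unc (pdu (J3 f)) z - 3 * unc (J3 f) z * unc (I4 f) z * unc (Dhat f (I5 f)) z)
    / (3 * unc (J3 f) z) * _ = _
  rw [M.rep_J3, M.rep_I1, M.rep_I7, M.rep_I4, M.rep_pdp M.rep_I5, M.rep_pdu M.rep_J3,
    M.rep_Dhat M.rep_I5, S.Qf, map_neg S.U, S.UE]
  have h := S.evalAt_E_ne_zero z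
  have hU := congrArg (evalAt z) S.Ulam
  simp only [map_add, map_sub, map_mul, map_neg, map_ofNat, map_pow] at hU ⊢
  field_simp
  linear_combination hU

end Models

/-- Where `I₃` does not vanish, neither does the total derivative of `φ`. -/
lemma Dhat_ne_zero_of_I3_ne_zero {f : Fn} {φ ψ χ lam : Fn3} {s : ℝ} {U : Set (ℝ × ℝ × ℝ)}
    (hct : IsContactTransformOn U φ ψ χ lam)
    (heqv : ContactEquivOn f (fun _ ub pb _ => s * pb + ub) U φ ψ χ)
    (hU : ∀ z ∈ Ω, (z.1, z.2.1, z.2.2.1) ∈ U) (hf : ContDiffOn ℝ ∞ (unc f) Ω)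
    (hI3 : ∀ z ∈ Ω, unc (I3 f) z ≠ 0) : ∀ z ∈ Ω, unc (Dhat f (lift φ)) z ≠ 0 := by
  intro z hz hz0
  have hE : ContinuousOn (unc (Dhat f (lift φ))) Ω := ((isRep_restrictSmooth hf).Dhat
    (isRep_restrictSmooth (hct.contDiffOn_lift hU).1)).contDiffOn.continuousOn
  have hA : ContinuousOn (fun w => unc (I3 f) w + unc (Dhat f (lift φ)) w ^ 3) Ω :=
    (contDiffOn_I3 hf).continuousOn.add (hE.pow 3)
  let Ω₁ : Opens Jet := ⟨_, hE.isOpen_inter_preimage Ω.isOpen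
    (isOpen_compl_singleton (x := (0 : ℝ)))⟩
  let Ω₂ : Opens Jet := ⟨_, hA.isOpen_inter_preimage Ω.isOpen
    (isOpen_compl_singleton (x := (0 : ℝ)))⟩
  obtain ⟨w, hw, hw0⟩ := exists_Dhat_ne_zero (Ω := Ω₂) (z := z) hct (fun v hv => hU v hv.1)
    (hf.mono fun v hv => hv.1) ⟨hz, by simpa [hz0] using hI3 z hz⟩
  obtain ⟨S, M⟩ := exists_models (Ω := Ω₁) hct heqv (fun v hv => hU v hv.1)
    (hf.mono fun v hv => hv.1) (fun v hv => hv.2)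
  have h1 := M.rep_I3 ⟨w, hw.1, hw0⟩
  have h2 := M.rep_Dhat M.rep_φ ⟨w, hw.1, hw0⟩
  refine hw.2 ?_
  change unc (I3 f) w = _ at h1
  change unc (Dhat f (lift φ)) w = evalAt _ S.E at h2
  simp [h1, h2]

end Models

/-- If the ODE `u''' = f`, with `f` smooth and `I₃ ≠ 0` on an open set
`D`, is equivalent to `ū''' = s·ū' + ū` under a contact transformation `(φ, ψ, χ)` with
contact multiplier `lam`, then, setting `a₁ := lam`, `η := D̂ₓχ/D̂ₓφ` and
`f̄ := s·χ + ψ`, the first-order PDE systems (i), (ii), (iii) of Proposition 4.1 hold. -/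
theorem construction_fiveDim_contact
    (D : Set (ℝ × ℝ × ℝ × ℝ)) (hDopen : IsOpen D)
    (f : Fn)
    (hf : ContDiffOn ℝ (⊤ : ℕ∞)
      (fun z : ℝ × ℝ × ℝ × ℝ => f z.1 z.2.1 z.2.2.1 z.2.2.2) D)
    (hI3 : ∀ x u p q, (x, u, p, q) ∈ D → I3 f x u p q ≠ 0)
    (s : ℝ) (U : Set (ℝ × ℝ × ℝ)) (φ ψ χ lam : Fn3)
    (hct : IsContactTransformOn U φ ψ χ lam)
    (heqv : ContactEquivOn f (fun _ ub pb _ => s * pb + ub) U φ ψ χ)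
    (a1 : Fn3) (ha1 : a1 = lam)
    (η : Fn)
    (hη : η = fun x u p q => Dhat f (lift χ) x u p q / Dhat f (lift φ) x u p q)
    (fbar : Fn3) (hfbar : fbar = fun x u p => s * χ x u p + ψ x u p) :
    ∀ x u p q, (x, u, p, q) ∈ D → (x, u, p) ∈ U →
      -- (i)  the system for the auxiliary function a₁
      (Dhat f (lift a1) x u p q = J3 f x u p q * I5 f x u p q * a1 x u p ∧
       pdu3 a1 x u p = -(Qinv f x u p q) * a1 x u p ∧
       pdp3 a1 x u p
         = (I4 f x u p q * I5 f x u p q - I7 f x u p q / J3 f x u p q) * a1 x u p ∧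
       pdq (lift a1) x u p q = 0) ∧
      -- (ii)  the system for φ
      (Dhat f (lift φ) x u p q = -(J3 f x u p q) ∧
       pdu3 φ x u p = -(I7 f x u p q) ∧
       pdp3 φ x u p = -(I4 f x u p q)) ∧
      -- (iii)  the system for η, χ, ψ
      (Dhat f η x u p q = -(J3 f x u p q) * fbar x u p ∧
       pdu η x u p q
         = ((s + (I5 f x u p q)^2)/2 + I2 f x u p q / (2 * (J3 f x u p q)^2)) * a1 x u p
             - I7 f x u p q * fbar x u p ∧
       pdp η x u p q
         = (I5 f x u p q / J3 f x u p q + I1 f x u p q / (3 * (J3 f x u p q)^2)) * a1 x u p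
             - I4 f x u p q * fbar x u p ∧
       pdq η x u p q = a1 x u p / (J3 f x u p q)^2 ∧
       Dhat f (lift χ) x u p q = -(J3 f x u p q) * η x u p q ∧
       pdu3 χ x u p = -(I5 f x u p q) * a1 x u p - I7 f x u p q * η x u p q ∧
       pdp3 χ x u p = -(a1 x u p / J3 f x u p q) - I4 f x u p q * η x u p q ∧
       I7 f x u p q * Dhat f (lift ψ) x u p q
         = J3 f x u p q * (pdu3 ψ x u p - a1 x u p) ∧
       pdx3 ψ x u p = χ x u p * pdx3 φ x u p - p * a1 x u p ∧
       pdp3 ψ x u p = -(I4 f x u p q) * χ x u p) ∧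
      -- moreover χ = D̂ₓψ/D̂ₓφ
      χ x u p = Dhat f (lift ψ) x u p q / Dhat f (lift φ) x u p q := by
  intro x u p q hD hpU
  subst ha1
  let W : TopologicalSpace.Opens Jet := ⟨D ∩ (fun z => (z.1, z.2.1, z.2.2.1)) ⁻¹' U,
    hDopen.inter (hct.isOpen.preimage (by fun_prop))⟩
  have hfW : ContDiffOn ℝ (⊤ : ℕ∞) (unc f) W := hf.mono fun _ h => h.1
  have hUW : ∀ z ∈ W, (z.1, z.2.1, z.2.2.1) ∈ U := fun _ h => h.2
  obtain ⟨S, M⟩ := exists_models hct heqv hUW hfW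
    (Dhat_ne_zero_of_I3_ne_zero hct heqv hUW hfW fun z hz => hI3 _ _ _ _ hz.1)
  have rη : IsRep η S.η := hη ▸ M.rep_η
  let z : W := ⟨(x, u, p, q), hD, hpU⟩
  have hE := S.evalAt_E_ne_zero z
  have eE := congrArg (evalAt z) S.Ee
  have eη : Dhat f η x u p q = _ := M.rep_Dhat rη z
  have eηu : pdu η x u p q = _ := M.rep_pdu rη z
  have eηp : pdp η x u p q = _ := M.rep_pdp rη z
  have eηq : pdq η x u p q = _ := M.rep_pdq rη z
  have eη0 : η x u p q = _ := rη z
  have eDφ : Dhat f (lift φ) x u p q = evalAt z S.E := M.rep_Dhat M.rep_φ z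
  have eDψ : Dhat f (lift ψ) x u p q = _ := M.rep_Dhat M.rep_ψ z
  have eDχ : Dhat f (lift χ) x u p q = _ := M.rep_Dhat M.rep_χ z
  have eDa : Dhat f (lift a1) x u p q = _ := M.rep_Dhat M.rep_lam z
  have eQa : pdq (lift a1) x u p q = _ := M.rep_pdq M.rep_lam z
  have eUa : pdu3 a1 x u p = _ := M.rep_pdu M.rep_lam z
  have ePa : pdp3 a1 x u p = _ := M.rep_pdp M.rep_lam z
  have eUφ : pdu3 φ x u p = _ := M.rep_pdu M.rep_φ z
  have ePφ : pdp3 φ x u p = _ := M.rep_pdp M.rep_φ z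
  have eUψ : pdu3 ψ x u p = _ := M.rep_pdu M.rep_ψ z
  have ePψ : pdp3 ψ x u p = _ := M.rep_pdp M.rep_ψ z
  have eUχ : pdu3 χ x u p = _ := M.rep_pdu M.rep_χ z
  have ePχ : pdp3 χ x u p = _ := M.rep_pdp M.rep_χ z
  have ea : a1 x u p = _ := M.rep_lam z
  have eψ : ψ x u p = _ := M.rep_ψ z
  have eχ : χ x u p = _ := M.rep_χ z
  have efbar : fbar x u p = _ := congrFun (congrFun (congrFun hfbar x) u) p
  have eI1 : I1 f x u p q = _ := M.rep_I1 z
  have eI2 : I2 f x u p q = _ := M.rep_I2 z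
  have eJ3 : J3 f x u p q = _ := M.rep_J3 z
  have eI4 : I4 f x u p q = _ := M.rep_I4 z
  have eI5 : I5 f x u p q = _ := M.rep_I5 z
  have eI7 : I7 f x u p q = _ := M.rep_I7 z
  have eQ : Qinv f x u p q * _ = _ := M.unc_Qinv_mul_lam z
  have hX := hct.contact_x x u p hpU
  simp only [efbar, eη0, eη, eηu, eηp, eηq, eDφ, eDψ, eDχ, eDa, eQa, eUa, ePa, eUφ, ePφ, eUψ,
    ePψ, eUχ, ePχ, eJ3, eI1, eI2, eI4, eI5, eI7]
  simp only [S.Dlam, S.Qlam, S.Plam, S.Qη, S.Pη, S.Uη, S.Pχ, S.Uχ, S.Pψ, S.Uψ, S.Dη', S.Dχ', S.Dψ',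
    S.Qf]
  rw [ea] at hX ⊢
  rw [eψ]
  rw [eχ] at hX ⊢
  simp only [map_add, map_sub, map_mul, map_neg, map_ofNat, map_pow, map_one, map_zero,
    ContactJet.i2, ContactJet.h, AlgHom.commutes, Algebra.algebraMap_self, RingHom.id_apply, M.s_eq]
    at eE ⊢
  have he := eq_inv_of_mul_eq_one_right eE
  rw [he]
  refine ⟨⟨?_, ?_, ?_, trivial⟩, ⟨?_, ?_, ?_⟩, ⟨?_, ?_, ?_, ?_, ?_, ?_, ?_, ?_, ?_, ?_⟩, ?_⟩
  · ring
  · linear_combination eQ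
  · field_simp
  · ring
  · ring
  · ring
  · ring
  · field_simp; ring
  · field_simp; ring
  · field_simp
  · ring
  · ring
  · field_simp; ring
  · ring
  · linear_combination hX
  · ring
  · field_simp

end
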